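/- For all integers t ≥ s ≥ 2 there exists a constant C = C(s,t) > 0 such that for all n, ex(n, H_{s,t}) ≤ C · n^{2 - 2/(2s+1)}. -/

import Mathlib

open SimpleGraph Filter

/-- `G` contains a copy of `H` (an injective graph homomorphism from `H` to `G`). -/
def SimpleGraph.Contains {α β : Type*} (G : SimpleGraph α) (H : SimpleGraph β) : Prop :=
  ∃ f : H →g G, Function.Injective f

/-- The Turán number `ex(n, H)`: the maximum number of edges in an `n`-vertex
graph containing no copy of `H`. -/
noncomputable def exNum {β : Type*} (n : ℕ) (H : SimpleGraph β) : ℕ :=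
  sSup {N : ℕ | ∃ G : SimpleGraph (Fin n), ¬ G.Contains H ∧ G.edgeSet.ncard = N}

/-- The graph `H_{s,t}`: two vertex-disjoint copies of `K_{s,t}` together with a perfect
matching joining the two images of every vertex of `K_{s,t}`. -/
def Hgraph (s t : ℕ) : SimpleGraph ((Fin s ⊕ Fin t) × Bool) :=
  SimpleGraph.fromRel fun x y =>
    (x.2 = y.2 ∧ (completeBipartiteGraph (Fin s) (Fin t)).Adj x.1 y.1) ∨
    (x.2 ≠ y.2 ∧ x.1 = y.1)

section Patterns

variable {V : Type*} [DecidableEq V]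

/-- The right neighbours of `x` in the bipartite graph with edge set `E`. -/
def nbrR (E : Finset (V × V)) (x : V) : Finset V :=
  (E.filter fun e => e.1 = x).image Prod.snd

/-- The left neighbours of `y` in the bipartite graph with edge set `E`. -/
def nbrL (E : Finset (V × V)) (y : V) : Finset V :=
  (E.filter fun e => e.2 = y).image Prod.fst

@[simp] lemma mem_nbrR {E : Finset (V × V)} {x y : V} : y ∈ nbrR E x ↔ (x, y) ∈ E := by
  simp [nbrR]

@[simp] lemma mem_nbrL {E : Finset (V × V)} {x y : V} : x ∈ nbrL E y ↔ (x, y) ∈ E := by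
  simp [nbrL]

/-- The bipartite graph with edge set `E` contains the bipartite pattern `R`, respecting sides. -/
def ContainsPattern {P Q : Type*} (R : P → Q → Prop) (E : Finset (V × V)) : Prop :=
  ∃ (f : P → V) (g : Q → V), Function.Injective f ∧ Function.Injective g ∧
    ∀ p q, R p q → (f p, g q) ∈ E

lemma ContainsPattern.mono {α P Q : Type*} {R : P → Q → Prop} {E F : Finset (α × α)}
    (h : ContainsPattern R E) (hEF : E ⊆ F) : ContainsPattern R F := by
  obtain ⟨f, g, hf, hg, hfg⟩ := h
  exact ⟨f, g, hf, hg, fun p q hpq => hEF (hfg p q hpq)⟩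

lemma ContainsPattern.comap {α P Q P' Q' : Type*} {R : P → Q → Prop} {R' : P' → Q' → Prop}
    {E : Finset (α × α)} (h : ContainsPattern R E) (i : P' → P) (j : Q' → Q)
    (hi : Function.Injective i) (hj : Function.Injective j)
    (hij : ∀ p q, R' p q → R (i p) (j q)) : ContainsPattern R' E := by
  obtain ⟨f, g, hf, hg, hfg⟩ := h
  exact ⟨f ∘ i, g ∘ j, hf.comp hi, hg.comp hj, fun p q hpq => hfg _ _ (hij p q hpq)⟩

/-- The theta graph: `t` internally disjoint paths of length three between two vertices, here the
left vertex `none` and the right vertex `none`. -/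
def thetaPattern (t : ℕ) (p q : Option (Fin t)) : Prop :=
  ¬(p = none ∧ q = none) ∧ (p = none ∨ q = none ∨ p = q)

/-- Either `E` has a matching of size `t`, or its edges are covered by fewer than `t` left and
fewer than `t` right vertices. -/
lemma exists_matching_or_cover (E : Finset (V × V)) (t : ℕ) :
    (∃ c d : Fin t → V, Function.Injective c ∧ Function.Injective d ∧ ∀ j, (c j, d j) ∈ E) ∨
    ∃ S T : Finset V, S.card < t ∧ T.card < t ∧ ∀ e ∈ E, e.1 ∈ S ∨ e.2 ∈ T := by
  induction t with
  | zero => exact Or.inl ⟨Fin.elim0, Fin.elim0, fun i => i.elim0, fun i => i.elim0,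
      fun i => i.elim0⟩
  | succ t ih =>
    rcases ih with ⟨c, d, hc, hd, hcd⟩ | ⟨S, T, hS, hT, h⟩
    · by_cases hcov : ∀ e ∈ E, e.1 ∈ Finset.univ.image c ∨ e.2 ∈ Finset.univ.image d
      · right
        refine ⟨_, _, ?_, ?_, hcov⟩ <;>
        · refine Nat.lt_succ_of_le (Finset.card_image_le.trans ?_)
          simp
      · push Not at hcov
        obtain ⟨⟨x, y⟩, hxy, hx, hy⟩ := hcov
        left
        refine ⟨Fin.cons x c, Fin.cons y d, ?_, ?_, ?_⟩
        · rw [Fin.cons_injective_iff]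
          exact ⟨by simpa using hx, hc⟩
        · rw [Fin.cons_injective_iff]
          exact ⟨by simpa using hy, hd⟩
        · intro j
          refine Fin.cases ?_ (fun i => ?_) j
          · simpa using hxy
          · simpa using hcd i
    · exact Or.inr ⟨S, T, by omega, by omega, h⟩

/-- In a theta-free graph, the edges between the neighbourhoods of `a` and `y` have a small
vertex cover. -/
lemma exists_cover_of_theta_free {E : Finset (V × V)} {t : ℕ}
    (hE : ¬ ContainsPattern (thetaPattern t) E) (a y : V) :
    ∃ S T : Finset V, S.card < t ∧ T.card < t ∧
      ∀ c d, (c, y) ∈ E → (a, d) ∈ E → (c, d) ∈ E → c ≠ a → d ≠ y → c ∈ S ∨ d ∈ T := by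
  rcases exists_matching_or_cover
    (E.filter fun e => (e.1, y) ∈ E ∧ (a, e.2) ∈ E ∧ e.1 ≠ a ∧ e.2 ≠ y) t with
    ⟨c, d, hc, hd, h⟩ | ⟨S, T, hS, hT, h⟩
  · simp only [Finset.mem_filter] at h
    refine (hE ⟨fun p => p.elim a c, fun q => q.elim y d, ?_, ?_, ?_⟩).elim
    · rintro (_ | i) (_ | j) hij
      · rfl
      · exact ((h j).2.2.2.1 hij.symm).elim
      · exact ((h i).2.2.2.1 hij).elim
      · exact congrArg some (hc hij)
    · rintro (_ | i) (_ | j) hij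
      · rfl
      · exact ((h j).2.2.2.2 hij.symm).elim
      · exact ((h i).2.2.2.2 hij).elim
      · exact congrArg some (hd hij)
    · rintro (_ | i) (_ | j) hij
      · simp [thetaPattern] at hij
      · exact (h j).2.2.1
      · exact (h i).2.1
      · have : i = j := by simpa [thetaPattern] using hij
        subst this
        exact (h i).1
  · exact ⟨S, T, hS, hT, fun c d h1 h2 h3 h4 h5 =>
      h (c, d) (Finset.mem_filter.2 ⟨h3, h1, h2, h4, h5⟩)⟩

lemma card_heavy_left_lt {E : Finset (V × V)} {t : ℕ}
    (hE : ¬ ContainsPattern (thetaPattern t) E) (a b : V) :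
    ((nbrL E b).filter fun c => c ≠ a ∧ t < (nbrR E c ∩ nbrR E a).card).card < t := by
  obtain ⟨S, T, hS, hT, h⟩ := exists_cover_of_theta_free hE a b
  refine lt_of_le_of_lt (Finset.card_le_card fun c hc => ?_) hS
  simp only [Finset.mem_filter, mem_nbrL] at hc
  obtain ⟨hcb, hca, hct⟩ := hc
  by_contra hcS
  have hsub : nbrR E c ∩ nbrR E a ⊆ insert b T := by
    intro d hd
    simp only [Finset.mem_inter, mem_nbrR] at hd
    by_cases hdb : d = b
    · simp [hdb]
    · exact Finset.mem_insert_of_mem ((h c d hcb hd.2 hd.1 hca hdb).resolve_left hcS)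
  have := Finset.card_le_card hsub
  have := Finset.card_insert_le b T
  omega

lemma card_heavy_right_lt {E : Finset (V × V)} {t : ℕ}
    (hE : ¬ ContainsPattern (thetaPattern t) E) (c b : V) :
    ((nbrR E c).filter fun y => y ≠ b ∧ t < (nbrL E y ∩ nbrL E b).card).card < t := by
  obtain ⟨S, T, hS, hT, h⟩ := exists_cover_of_theta_free hE c b
  refine lt_of_le_of_lt (Finset.card_le_card fun y hy => ?_) hT
  simp only [Finset.mem_filter, mem_nbrR] at hy
  obtain ⟨hcy, hyb, hyt⟩ := hy
  by_contra hyT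
  have hsub : nbrL E y ∩ nbrL E b ⊆ insert c S := by
    intro x hx
    simp only [Finset.mem_inter, mem_nbrL] at hx
    by_cases hxc : x = c
    · simp [hxc]
    · exact Finset.mem_insert_of_mem ((h x y hx.2 hcy hx.1 hxc hyb).resolve_right hyT)
  have := Finset.card_le_card hsub
  have := Finset.card_insert_le c S
  omega

/-- A theta-free bipartite graph with minimum degree at least `D` has at least about `D ^ 3`
right vertices. -/
lemma theta_free_min_degree {E : Finset (V × V)} {X Y : Finset V} {t D : ℕ}
    (hE : ¬ ContainsPattern (thetaPattern t) E) (hX : X.Nonempty) (hEXY : E ⊆ X ×ˢ Y)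
    (hDX : ∀ x ∈ X, D ≤ (nbrR E x).card) (hDY : ∀ y ∈ Y, D ≤ (nbrL E y).card) :
    D * (D - t) * (D - t ^ 2) ≤ t ^ 3 * Y.card := by
  have hmem : ∀ {x y}, (x, y) ∈ E → x ∈ X ∧ y ∈ Y := fun h => by
    simpa using hEXY h
  obtain ⟨a, ha⟩ := hX
  set N₁ := nbrR E a with hN₁
  set Z := X.filter fun c => c ≠ a ∧ (nbrR E c ∩ N₁).Nonempty ∧ (nbrR E c ∩ N₁).card ≤ t
    with hZ
  set Yc : V → Finset V := fun c =>
    (nbrR E c \ N₁).filter fun y => ∀ b ∈ nbrR E c ∩ N₁, (nbrL E y ∩ nbrL E b).card ≤ t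
    with hYc
  have h1 : D * (D - t) ≤ t * Z.card := by
    have hb : ∀ b ∈ N₁, D - t ≤ (Z.filter fun c => b ∈ nbrR E c ∩ N₁).card := by
      intro b hb
      have hab : (a, b) ∈ E := by simpa [hN₁] using hb
      have hlt := card_heavy_left_lt hE a b
      have hd := hDY b (hmem hab).2
      have hsub : nbrL E b ⊆ (Z.filter fun c => b ∈ nbrR E c ∩ N₁) ∪
          insert a ((nbrL E b).filter fun c => c ≠ a ∧ t < (nbrR E c ∩ nbrR E a).card) := by
        intro c hc
        have hcb : (c, b) ∈ E := by simpa using hc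
        have hbm : b ∈ nbrR E c ∩ N₁ := by simp [hcb, hb]
        by_cases hca : c = a
        · simp [hca]
        by_cases hw : t < (nbrR E c ∩ nbrR E a).card
        · exact Finset.mem_union_right _ (Finset.mem_insert_of_mem
            (Finset.mem_filter.2 ⟨hc, hca, hw⟩))
        · refine Finset.mem_union_left _ (Finset.mem_filter.2 ⟨?_, hbm⟩)
          exact Finset.mem_filter.2 ⟨(hmem hcb).1, hca, ⟨b, hbm⟩, not_lt.1 hw⟩
      have h2 := Finset.card_le_card hsub
      have h3 := Finset.card_union_le (Z.filter fun c => b ∈ nbrR E c ∩ N₁)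
          (insert a ((nbrL E b).filter fun c => c ≠ a ∧ t < (nbrR E c ∩ nbrR E a).card))
      have h4 := Finset.card_insert_le a
        ((nbrL E b).filter fun c => c ≠ a ∧ t < (nbrR E c ∩ nbrR E a).card)
      omega
    calc D * (D - t) ≤ N₁.card * (D - t) := Nat.mul_le_mul_right _ (hDX a ha)
      _ ≤ ∑ b ∈ N₁, (Z.filter fun c => b ∈ nbrR E c ∩ N₁).card := by
        rw [← smul_eq_mul]; exact Finset.card_nsmul_le_sum _ _ _ hb
      _ = ∑ c ∈ Z, (N₁.filter fun b => b ∈ nbrR E c ∩ N₁).card :=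
        (Finset.sum_card_bipartiteAbove_eq_sum_card_bipartiteBelow
          (fun b c => b ∈ nbrR E c ∩ N₁))
      _ ≤ ∑ c ∈ Z, t := by
        refine Finset.sum_le_sum fun c hc => ?_
        refine le_trans (Finset.card_le_card fun b hb => (Finset.mem_filter.1 hb).2) ?_
        exact (Finset.mem_filter.1 hc).2.2.2
      _ = t * Z.card := by simp [mul_comm]
  have h2 : ∀ c ∈ Z, D - t ^ 2 ≤ (Yc c).card := by
    intro c hc
    obtain ⟨hcX, hca, -, hct⟩ := Finset.mem_filter.1 hc
    have hd := hDX c hcX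
    set B := (nbrR E c ∩ N₁).biUnion fun b =>
      insert b ((nbrR E c).filter fun y => y ≠ b ∧ t < (nbrL E y ∩ nbrL E b).card) with hB
    have hBc : B.card ≤ t * t := by
      refine (Finset.card_biUnion_le_card_mul _ _ t fun b _ => ?_).trans
        (Nat.mul_le_mul_right _ hct)
      exact (Finset.card_insert_le _ _).trans (card_heavy_right_lt hE c b)
    have hsub : nbrR E c ⊆ Yc c ∪ B := by
      intro y hy
      by_cases hyB : y ∈ B
      · exact Finset.mem_union_right _ hyB
      refine Finset.mem_union_left _ (Finset.mem_filter.2 ⟨?_, fun b hb => ?_⟩)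
      · refine Finset.mem_sdiff.2 ⟨hy, fun hyN => hyB ?_⟩
        exact Finset.mem_biUnion.2 ⟨y, Finset.mem_inter.2 ⟨hy, hyN⟩, Finset.mem_insert_self _ _⟩
      · by_contra hlt
        refine hyB (Finset.mem_biUnion.2 ⟨b, hb, ?_⟩)
        by_cases hyb : y = b
        · simp [hyb]
        · exact Finset.mem_insert_of_mem (Finset.mem_filter.2 ⟨hy, hyb, not_le.1 hlt⟩)
    have h2 := Finset.card_le_card hsub
    have h3 := Finset.card_union_le (Yc c) B
    rw [pow_two]
    omega
  have h3 : ∀ y ∈ Y, (Z.filter fun c => y ∈ Yc c).card ≤ t ^ 2 := by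
    intro y _
    obtain ⟨S, T, hS, hT, h⟩ := exists_cover_of_theta_free hE a y
    have hsub : (Z.filter fun c => y ∈ Yc c) ⊆
        S ∪ (T.filter fun b => (nbrL E y ∩ nbrL E b).card ≤ t).biUnion
          fun b => nbrL E y ∩ nbrL E b := by
      intro c hc
      obtain ⟨hcZ, hyc⟩ := Finset.mem_filter.1 hc
      obtain ⟨-, hca, ⟨b, hb⟩, -⟩ := Finset.mem_filter.1 hcZ
      obtain ⟨hy, hyb⟩ := Finset.mem_filter.1 hyc
      obtain ⟨hy1, hy2⟩ := Finset.mem_sdiff.1 hy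
      obtain ⟨hb1, hb2⟩ := Finset.mem_inter.1 hb
      have hby : b ≠ y := fun hby => hy2 (hby ▸ hb2)
      rw [mem_nbrR] at hy1 hb1
      have hb3 : (a, b) ∈ E := by simpa [hN₁] using hb2
      rcases h c b hy1 hb3 hb1 hca hby with h | h
      · exact Finset.mem_union_left _ h
      · refine Finset.mem_union_right _ (Finset.mem_biUnion.2
          ⟨b, Finset.mem_filter.2 ⟨h, hyb b hb⟩, ?_⟩)
        simp [hy1, hb1]
    have h2 := Finset.card_le_card hsub
    have h3 := Finset.card_union_le S ((T.filter fun b =>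
      (nbrL E y ∩ nbrL E b).card ≤ t).biUnion fun b => nbrL E y ∩ nbrL E b)
    have h4 := Finset.card_biUnion_le_card_mul (T.filter fun b =>
      (nbrL E y ∩ nbrL E b).card ≤ t) (fun b => nbrL E y ∩ nbrL E b) t
      fun b hb => (Finset.mem_filter.1 hb).2
    have h5 := Finset.card_filter_le T fun b => (nbrL E y ∩ nbrL E b).card ≤ t
    have h6 := Nat.mul_le_mul_right t h5
    have h7 : (T.card + 1) * t ≤ t * t := Nat.mul_le_mul_right t hT
    nlinarith
  have h4 : Z.card * (D - t ^ 2) ≤ Y.card * t ^ 2 := by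
    calc Z.card * (D - t ^ 2) ≤ ∑ c ∈ Z, (Y.filter fun y => y ∈ Yc c).card := by
          rw [← smul_eq_mul]
          refine Finset.card_nsmul_le_sum _ _ _ fun c hc => (h2 c hc).trans ?_
          refine Finset.card_le_card fun y hy => Finset.mem_filter.2 ⟨?_, hy⟩
          have := (Finset.mem_sdiff.1 (Finset.mem_filter.1 hy).1).1
          exact (hmem (mem_nbrR.1 this)).2
      _ = ∑ y ∈ Y, (Z.filter fun c => y ∈ Yc c).card :=
          Finset.sum_card_bipartiteAbove_eq_sum_card_bipartiteBelow (fun c y => y ∈ Yc c)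
      _ ≤ Y.card * t ^ 2 := by
          rw [← smul_eq_mul]
          exact Finset.sum_le_card_nsmul _ _ _ h3
  calc D * (D - t) * (D - t ^ 2) ≤ t * Z.card * (D - t ^ 2) := Nat.mul_le_mul_right _ h1
    _ = t * (Z.card * (D - t ^ 2)) := by ring
    _ ≤ t * (Y.card * t ^ 2) := Nat.mul_le_mul_left _ h4
    _ = t ^ 3 * Y.card := by ring

/-- A bipartite graph of large average degree has a subgraph of large minimum degree. -/
lemma exists_min_degree_subgraph {W : Finset V} {E : Finset (V × V)} (hEW : E ⊆ W ×ˢ W)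
    {δ : ℝ} (hδ₀ : 0 ≤ δ) (hδ : 2 * δ * W.card < E.card) :
    ∃ (X Y : Finset V) (E' : Finset (V × V)), Y ⊆ W ∧ E' ⊆ E ∧ E' ⊆ X ×ˢ Y ∧
      E'.Nonempty ∧ (∀ x ∈ X, δ ≤ (nbrR E' x).card) ∧ ∀ y ∈ Y, δ ≤ (nbrL E' y).card := by
  set sub : Finset V × Finset V → Finset (V × V) :=
    fun A => E.filter fun e => e.1 ∈ A.1 ∧ e.2 ∈ A.2 with hsub
  set Φ : Finset V × Finset V → ℝ :=
    fun A => (sub A).card - δ * (A.1.card + A.2.card) with hΦ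
  obtain ⟨⟨X, Y⟩, hXY, hmax⟩ := (W.powerset ×ˢ W.powerset).exists_max_image Φ
    ⟨(∅, ∅), by simp⟩
  obtain ⟨hX, hY⟩ : X ⊆ W ∧ Y ⊆ W := by simpa using hXY
  refine ⟨X, Y, sub (X, Y), hY, Finset.filter_subset _ _, fun e he => ?_, ?_, ?_, ?_⟩
  · simpa using (Finset.mem_filter.1 he).2
  · have hW : sub (W, W) = E := Finset.filter_true_of_mem fun e he => by
      simpa using hEW he
    have h1 : 0 < Φ (W, W) := by simp only [hΦ, hW]; linarith
    rw [Finset.nonempty_iff_ne_empty]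
    intro hempty
    have h2 := hmax (W, W) (by simp)
    have h3 : Φ (X, Y) = - (δ * (X.card + Y.card)) := by simp [hΦ, hempty]
    have : 0 ≤ δ * ((X.card : ℝ) + Y.card) := by positivity
    linarith
  · intro x hx
    have h1 := hmax (X.erase x, Y) (by simp [hY, (Finset.erase_subset x X).trans hX])
    have h2 : sub (X, Y) ⊆ sub (X.erase x, Y) ∪ (nbrR (sub (X, Y)) x).image fun y => (x, y) := by
      rintro ⟨u, v⟩ he
      obtain ⟨huv, hu, hv⟩ := Finset.mem_filter.1 he
      by_cases hux : u = x
      · subst hux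
        exact Finset.mem_union_right _ (Finset.mem_image.2 ⟨v, by simpa using he, rfl⟩)
      · exact Finset.mem_union_left _ (Finset.mem_filter.2
          ⟨huv, Finset.mem_erase.2 ⟨hux, hu⟩, hv⟩)
    have h3 : (sub (X, Y)).card ≤ (sub (X.erase x, Y)).card + (nbrR (sub (X, Y)) x).card :=
      (Finset.card_le_card h2).trans ((Finset.card_union_le _ _).trans
        (Nat.add_le_add_left Finset.card_image_le _))
    have h4 : ((sub (X, Y)).card : ℝ) ≤
      (sub (X.erase x, Y)).card + (nbrR (sub (X, Y)) x).card := by exact_mod_cast h3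
    have h5 : ((X.erase x).card : ℝ) + 1 = X.card := by
      exact_mod_cast Finset.card_erase_add_one hx
    simp only [hΦ] at h1
    rw [← h5] at h1
    linarith
  · intro y hy
    have h1 := hmax (X, Y.erase y) (by simp [hX, (Finset.erase_subset y Y).trans hY])
    have h2 : sub (X, Y) ⊆ sub (X, Y.erase y) ∪ (nbrL (sub (X, Y)) y).image fun x => (x, y) := by
      rintro ⟨u, v⟩ he
      obtain ⟨huv, hu, hv⟩ := Finset.mem_filter.1 he
      by_cases hvy : v = y
      · subst hvy
        exact Finset.mem_union_right _ (Finset.mem_image.2 ⟨u, by simpa using he, rfl⟩)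
      · exact Finset.mem_union_left _ (Finset.mem_filter.2
          ⟨huv, hu, Finset.mem_erase.2 ⟨hvy, hv⟩⟩)
    have h3 : (sub (X, Y)).card ≤ (sub (X, Y.erase y)).card + (nbrL (sub (X, Y)) y).card :=
      (Finset.card_le_card h2).trans ((Finset.card_union_le _ _).trans
        (Nat.add_le_add_left Finset.card_image_le _))
    have h4 : ((sub (X, Y)).card : ℝ) ≤
      (sub (X, Y.erase y)).card + (nbrL (sub (X, Y)) y).card := by exact_mod_cast h3
    have h5 : ((Y.erase y).card : ℝ) + 1 = Y.card := by
      exact_mod_cast Finset.card_erase_add_one hy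
    simp only [hΦ] at h1
    rw [← h5] at h1
    linarith

/-- Every bipartite graph on `n` vertices with more than `C * n ^ p` edges contains the pattern
`R`, for some constant `C`. -/
def Forces {P Q : Type} (R : P → Q → Prop) (p : ℝ) : Prop :=
  ∃ C : ℝ, 0 < C ∧ ∀ (V : Type) [DecidableEq V] (W : Finset V) (E : Finset (V × V)),
    E ⊆ W ×ˢ W → C * (W.card : ℝ) ^ p < E.card → ContainsPattern R E

lemma card_pos_of_edges {α : Type*} {W : Finset α} {E : Finset (α × α)} (hEW : E ⊆ W ×ˢ W)
    (hE : E.Nonempty) : 0 < W.card := by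
  obtain ⟨e, he⟩ := hE
  exact Finset.card_pos.2 ⟨e.1, (Finset.mem_product.1 (hEW he)).1⟩

theorem forces_theta (t : ℕ) : Forces (thetaPattern t) (4 / 3) := by
  set c : ℝ := 2 * t ^ 2 + 2 * t + 2 with hc
  have hc0 : 0 < c := by positivity
  refine ⟨4 * c, by positivity, fun V _ W E hEW hE => ?_⟩
  by_contra hfree
  have hEpos : (0 : ℝ) < E.card := lt_of_le_of_lt (by positivity) hE
  have hnN : 0 < W.card := card_pos_of_edges hEW (Finset.card_pos.1 (by exact_mod_cast hEpos))
  have hn : (1 : ℝ) ≤ W.card := by exact_mod_cast hnN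
  set r : ℝ := (W.card : ℝ) ^ (1 / 3 : ℝ) with hr
  have hr1 : 1 ≤ r := Real.one_le_rpow hn (by norm_num)
  have hr3 : r ^ 3 = W.card := by
    rw [hr, ← Real.rpow_natCast, ← Real.rpow_mul (by positivity)]
    norm_num
  have hr4 : (W.card : ℝ) ^ (4 / 3 : ℝ) = W.card * r := by
    rw [hr, show (4 / 3 : ℝ) = 1 + 1 / 3 by norm_num, Real.rpow_add (by positivity),
      Real.rpow_one]
  rw [hr4] at hE
  obtain ⟨X, Y, E', hYW, hE', hEXY, hne, hDX, hDY⟩ :=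
    exists_min_degree_subgraph hEW (δ := c * r) (by positivity) (by nlinarith)
  have hXne : X.Nonempty := by
    obtain ⟨e, he⟩ := hne
    exact ⟨e.1, (Finset.mem_product.1 (hEXY he)).1⟩
  have key := theta_free_min_degree (D := ⌈c * r⌉₊) (fun h => hfree (h.mono hE')) hXne hEXY
    (fun x hx => Nat.ceil_le.2 (hDX x hx)) (fun y hy => Nat.ceil_le.2 (hDY y hy))
  set D := ⌈c * r⌉₊ with hD
  have hDr : c * r ≤ D := Nat.le_ceil _
  have hDc : c ≤ D := le_trans (by nlinarith) hDr
  have hDt : 2 * t ^ 2 + 2 * t + 2 ≤ D := by exact_mod_cast hc ▸ hDc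
  have h1 : (D : ℝ) / 2 ≤ ((D - t : ℕ) : ℝ) := by
    rw [Nat.cast_sub (by nlinarith)]
    have : (2 * t + 2 : ℝ) ≤ D := by nlinarith [sq_nonneg (t : ℝ)]
    linarith
  have h2 : (D : ℝ) / 2 ≤ ((D - t ^ 2 : ℕ) : ℝ) := by
    rw [Nat.cast_sub (by nlinarith)]
    push_cast
    have : (2 * t ^ 2 : ℝ) ≤ D := by
      have : (0 : ℝ) ≤ t := by positivity
      nlinarith
    linarith
  have key' : (D : ℝ) * (D - t : ℕ) * (D - t ^ 2 : ℕ) ≤ t ^ 3 * Y.card := by exact_mod_cast key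
  have hYc : (Y.card : ℝ) ≤ r ^ 3 := by
    rw [hr3]; exact_mod_cast Finset.card_le_card hYW
  have h3 : (D : ℝ) * (D / 2) * (D / 2) ≤ t ^ 3 * r ^ 3 := by
    calc (D : ℝ) * (D / 2) * (D / 2) ≤ (D : ℝ) * (D - t : ℕ) * (D - t ^ 2 : ℕ) := by gcongr
      _ ≤ t ^ 3 * Y.card := key'
      _ ≤ t ^ 3 * r ^ 3 := by gcongr
  have h4 : (c * r) ^ 3 ≤ (D : ℝ) ^ 3 := by gcongr
  have h5 : ((2 * t + 2) * r) ^ 3 ≤ (c * r) ^ 3 := by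
    gcongr
    rw [hc]
    nlinarith [sq_nonneg (t : ℝ)]
  have h6 : (0 : ℝ) < r ^ 3 := by positivity
  have h7 : ((2 * t + 2 : ℝ)) ^ 3 ≤ 4 * t ^ 3 := by
    refine le_of_mul_le_mul_right ?_ h6
    nlinarith
  have h8 : (0 : ℝ) ≤ t := by positivity
  nlinarith [pow_nonneg h8 2, pow_nonneg h8 3]

/-- A subadditive set function bounded by `B` on sets of size at most `k` is bounded by `N * B`
on sets of size at most `N * k`. -/
lemma le_mul_of_subadditive {f : Finset V → ℝ} {B : ℝ} {k : ℕ} (h0 : f ∅ ≤ 0)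
    (hf : ∀ S T, f (S ∪ T) ≤ f S + f T) (hB : ∀ T, T.card ≤ k → f T ≤ B)
    (N : ℕ) (T : Finset V) (hT : T.card ≤ N * k) : f T ≤ N * B := by
  induction N generalizing T with
  | zero =>
    have : T = ∅ := by simpa using hT
    simpa [this] using h0
  | succ N ih =>
    obtain ⟨S, hST, hS⟩ := Finset.exists_subset_card_eq (min_le_right k T.card)
    have h1 := hB S (by omega)
    have h2 := ih (T \ S) (by
      rw [Finset.card_sdiff_of_subset hST, hS]
      rw [Nat.succ_mul] at hT
      omega)
    have h3 := hf S (T \ S)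
    rw [Finset.union_sdiff_of_subset hST] at h3
    push_cast
    linarith

/-- The edges of `E` with both ends in `A`. -/
def edgesIn (E : Finset (V × V)) (A : Finset V) : Finset (V × V) :=
  E.filter fun e => e.1 ∈ A ∧ e.2 ∈ A

/-- The edges of `F` with one end in `S` and the other in `T`. -/
def edgesBetween (F : Finset (V × V)) (S T : Finset V) : Finset (V × V) :=
  F.filter fun e => (e.1 ∈ S ∧ e.2 ∈ T) ∨ (e.2 ∈ S ∧ e.1 ∈ T)

lemma sum_card_fiber_le {α : Type*} [DecidableEq α] (F : Finset α) (S : Finset V) (f : α → V) :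
    ∑ v ∈ S, (F.filter fun e => f e = v).card ≤ F.card := by
  rw [← Finset.card_biUnion fun u _ v _ huv => Finset.disjoint_filter.2
    fun e _ h1 h2 => huv (h1.symm.trans h2)]
  exact Finset.card_le_card (Finset.biUnion_subset.2 fun v _ => Finset.filter_subset _ _)

lemma sum_card_nbrR_le (F : Finset (V × V)) (S : Finset V) :
    ∑ v ∈ S, (nbrR F v).card ≤ F.card :=
  (Finset.sum_le_sum fun _ _ => Finset.card_image_le).trans
    (sum_card_fiber_le F S _)

lemma sum_card_nbrL_le (F : Finset (V × V)) (S : Finset V) :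
    ∑ v ∈ S, (nbrL F v).card ≤ F.card :=
  (Finset.sum_le_sum fun _ _ => Finset.card_image_le).trans
    (sum_card_fiber_le F S _)

/-- A subset maximizing the number of edges it spans divided by the `p`-th power of its size. -/
lemma exists_densest_subset {p C : ℝ} (hp : 0 < p) (hC : 0 < C) {W : Finset V}
    {E : Finset (V × V)} (hEW : E ⊆ W ×ˢ W) (hE : C * (W.card : ℝ) ^ p < E.card) :
    ∃ (U : Finset V) (c : ℝ), U ⊆ W ∧ 0 < U.card ∧ C < c ∧
      ((edgesIn E U).card : ℝ) = c * (U.card : ℝ) ^ p ∧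
      ∀ A ⊆ W, ((edgesIn E A).card : ℝ) ≤ c * (A.card : ℝ) ^ p := by
  have hEpos : (0 : ℝ) < E.card := lt_of_le_of_lt (by positivity) hE
  have hW0 : 0 < W.card := card_pos_of_edges hEW (Finset.card_pos.1 (by exact_mod_cast hEpos))
  have hpow : ∀ A : Finset V, 0 < A.card → 0 < (A.card : ℝ) ^ p := fun A hA =>
    Real.rpow_pos_of_pos (by exact_mod_cast hA) p
  obtain ⟨U, hU, hmax⟩ := (W.powerset.filter fun A => 0 < A.card).exists_max_image
    (fun A => ((edgesIn E A).card : ℝ) / (A.card : ℝ) ^ p) ⟨W, by simpa using Finset.card_pos.1 hW0⟩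
  simp only [Finset.mem_filter, Finset.mem_powerset] at hU hmax
  have hCc : C < ((edgesIn E U).card : ℝ) / (U.card : ℝ) ^ p := by
    refine lt_of_lt_of_le ?_ (hmax W ⟨subset_rfl, hW0⟩)
    have hsW : edgesIn E W = E := Finset.filter_true_of_mem fun e he => by simpa using hEW he
    rw [hsW, lt_div_iff₀ (hpow W hW0)]
    exact hE
  refine ⟨U, _, hU.1, hU.2, hCc, (div_mul_cancel₀ _ (hpow U hU.2).ne').symm, fun A hA => ?_⟩
  rcases A.eq_empty_or_nonempty with rfl | hne
  · simp [edgesIn, Real.zero_rpow hp.ne']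
  · have hA0 := Finset.card_pos.2 hne
    exact (div_le_iff₀ (hpow A hA0)).1 (hmax A ⟨hA, hA0⟩)

/-- A dense graph contains a subgraph of at least the same density, up to a constant, whose
maximum degree is at most a constant times its average degree. -/
lemma exists_almost_regular {p : ℝ} (hp : 1 < p) (hp2 : p ≤ 2) :
    ∃ K C₀ : ℝ, 1 ≤ K ∧ 0 < C₀ ∧ ∀ (V : Type) [DecidableEq V] (C : ℝ), C₀ ≤ C →
      ∀ (W : Finset V) (E : Finset (V × V)), E ⊆ W ×ˢ W → C * (W.card : ℝ) ^ p < E.card →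
      ∃ (U : Finset V) (F : Finset (V × V)), F ⊆ E ∧ F ⊆ U ×ˢ U ∧ F.Nonempty ∧
        C / 2 * (U.card : ℝ) ^ p ≤ F.card ∧
        ∀ v, (nbrR F v).card * (U.card : ℝ) ≤ K * F.card ∧
          (nbrL F v).card * (U.card : ℝ) ≤ K * F.card := by
  obtain ⟨R, hR⟩ : ∃ R : ℕ, 1 ≤ R ∧ 18 ≤ (R : ℝ) ^ (p - 1) := by
    have := ((tendsto_rpow_atTop (sub_pos.2 hp)).comp
      tendsto_natCast_atTop_atTop).eventually_ge_atTop (18 : ℝ)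
    exact ((eventually_ge_atTop 1).and this).exists
  obtain ⟨hR1, hR18⟩ := hR
  have hR1' : (1 : ℝ) ≤ R := by exact_mod_cast hR1
  refine ⟨4 * R, R, by linarith, by linarith, fun V _ C hC W E hEW hE => ?_⟩
  obtain ⟨U, c, hUW, hm, hCc, he, hbound⟩ :=
    exists_densest_subset (by linarith) (by linarith) hEW hE
  have hm1 : (1 : ℝ) ≤ U.card := by exact_mod_cast hm
  have hmp : 0 < (U.card : ℝ) ^ p := by positivity
  have hc0 : 0 < c := by linarith
  have hRm : R ≤ U.card := by
    have h1 : ((edgesIn E U).card : ℝ) ≤ (U.card : ℝ) ^ (2 : ℝ) := by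
      have : (edgesIn E U).card ≤ (U ×ˢ U).card := Finset.card_le_card fun e he => by
        simpa using (Finset.mem_filter.1 he).2
      rw [Finset.card_product] at this
      rw [Real.rpow_two, pow_two]
      exact_mod_cast this
    have h2 : (U.card : ℝ) ^ (2 : ℝ) ≤ U.card * (U.card : ℝ) ^ p := by
      rw [← Real.rpow_one_add' (by positivity) (by linarith)]
      exact Real.rpow_le_rpow_of_exponent_le hm1 (by linarith)
    have h3 : c ≤ U.card := le_of_mul_le_mul_right (by linarith) hmp
    have : (R : ℝ) ≤ U.card := by linarith
    exact_mod_cast this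
  set S := U.filter fun v =>
    2 * R * ((edgesIn E U).card : ℝ) < ((nbrR (edgesIn E U) v).card + (nbrL (edgesIn E U) v).card) * (U.card : ℝ)
  have hepos : 0 < ((edgesIn E U).card : ℝ) := by rw [he]; positivity
  have hScard : (S.card : ℝ) * R ≤ U.card := by
    have h1 : (S.card : ℝ) * (2 * R * (edgesIn E U).card) ≤
        ∑ v ∈ S, (((nbrR (edgesIn E U) v).card : ℝ) + (nbrL (edgesIn E U) v).card) * U.card := by
      rw [← nsmul_eq_mul]
      exact Finset.card_nsmul_le_sum _ _ _ fun v hv => (Finset.mem_filter.1 hv).2.le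
    rw [← Finset.sum_mul, Finset.sum_add_distrib] at h1
    have h2 : ∑ v ∈ S, ((nbrR (edgesIn E U) v).card : ℝ) ≤ (edgesIn E U).card := by
      exact_mod_cast sum_card_nbrR_le (edgesIn E U) S
    have h3 : ∑ v ∈ S, ((nbrL (edgesIn E U) v).card : ℝ) ≤ (edgesIn E U).card := by
      exact_mod_cast sum_card_nbrL_le (edgesIn E U) S
    have h4 : (S.card : ℝ) * (2 * R * (edgesIn E U).card) ≤ ((edgesIn E U).card + (edgesIn E U).card) * U.card :=
      h1.trans (by gcongr)
    refine le_of_mul_le_mul_right (a := 2 * ((edgesIn E U).card : ℝ)) ?_ (by positivity)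
    linarith
  set k := U.card / R + 1 with hk
  have hkR : U.card ≤ R * k := by
    have := Nat.lt_mul_div_succ U.card (show 0 < R by omega)
    rw [hk]
    exact this.le
  have hk2 : (k : ℝ) * R ≤ 2 * U.card := by
    have h1 : k * R ≤ 2 * U.card := by
      have := Nat.div_mul_le_self U.card R
      rw [hk, Nat.add_mul]
      omega
    exact_mod_cast h1
  have hT : ∀ T, T.card ≤ k →
      ((edgesBetween (edgesIn E U) S T).card : ℝ) ≤ c * (3 * U.card / R) ^ p := by
    intro T hTk
    have h1 : edgesBetween (edgesIn E U) S T ⊆ edgesIn E (S ∪ (T ∩ U)) := by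
      intro e he
      obtain ⟨he1, he2⟩ := Finset.mem_filter.1 he
      obtain ⟨he3, he4, he5⟩ := Finset.mem_filter.1 he1
      refine Finset.mem_filter.2 ⟨he3, ?_⟩
      simp only [Finset.mem_union, Finset.mem_inter]
      tauto
    have h2 : S ∪ (T ∩ U) ⊆ W := Finset.union_subset ((Finset.filter_subset _ _).trans hUW)
      (Finset.inter_subset_right.trans hUW)
    have h3 : ((edgesBetween (edgesIn E U) S T).card : ℝ) ≤ (edgesIn E (S ∪ (T ∩ U))).card := by
      exact_mod_cast Finset.card_le_card h1
    refine (h3.trans (hbound _ h2)).trans ?_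
    gcongr
    rw [le_div_iff₀ (by linarith)]
    have h4 : ((S ∪ (T ∩ U)).card : ℝ) ≤ S.card + k := by
      have := Finset.card_union_le S (T ∩ U)
      have := Finset.card_le_card (Finset.inter_subset_left (s₁ := T) (s₂ := U))
      exact_mod_cast (by omega : (S ∪ (T ∩ U)).card ≤ S.card + k)
    nlinarith
  have htotal : ((edgesBetween (edgesIn E U) S U).card : ℝ) ≤ R * (c * (3 * U.card / R) ^ p) := by
    refine le_mul_of_subadditive (f := fun T => ((edgesBetween (edgesIn E U) S T).card : ℝ)) (k := k) ?_ ?_ hT R U hkR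
    · simp [edgesBetween]
    · intro A B
      have h1 : edgesBetween (edgesIn E U) S (A ∪ B) ⊆ edgesBetween (edgesIn E U) S A ∪ edgesBetween (edgesIn E U) S B := by
        intro e he
        simp only [edgesBetween, Finset.mem_union, Finset.mem_filter] at he ⊢
        tauto
      exact_mod_cast (Finset.card_le_card h1).trans (Finset.card_union_le _ _)
  have hhalf : ((edgesBetween (edgesIn E U) S U).card : ℝ) ≤ (edgesIn E U).card / 2 := by
    refine htotal.trans ?_
    have h1 : (3 * (U.card : ℝ) / R) ^ p = 3 ^ p * (U.card : ℝ) ^ p / R ^ p := by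
      rw [Real.div_rpow (by positivity) (by positivity), Real.mul_rpow (by norm_num)
        (by positivity)]
    have h2 : (R : ℝ) ^ p = R * (R : ℝ) ^ (p - 1) := by
      rw [← Real.rpow_one_add' (by positivity) (by linarith)]
      congr 1; ring
    have h3 : (3 : ℝ) ^ p ≤ 9 := by
      calc (3 : ℝ) ^ p ≤ 3 ^ (2 : ℝ) := Real.rpow_le_rpow_of_exponent_le (by norm_num) hp2
        _ = 9 := by norm_num
    rw [h1, h2, he]
    have h4 : (R : ℝ) * (c * (3 ^ p * (U.card : ℝ) ^ p / (R * (R : ℝ) ^ (p - 1)))) =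
        c * (U.card : ℝ) ^ p * (3 ^ p / (R : ℝ) ^ (p - 1)) := by
      field_simp
    rw [h4]
    have h5 : (3 : ℝ) ^ p / (R : ℝ) ^ (p - 1) ≤ 1 / 2 := by
      rw [div_le_iff₀ (by positivity)]
      linarith
    calc c * (U.card : ℝ) ^ p * (3 ^ p / (R : ℝ) ^ (p - 1))
        ≤ c * (U.card : ℝ) ^ p * (1 / 2) := by gcongr
      _ = _ := by ring
  set F := edgesIn E U \ edgesBetween (edgesIn E U) S U
  have hFcard : ((edgesIn E U).card : ℝ) / 2 ≤ F.card := by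
    have h1 : F.card + (edgesBetween (edgesIn E U) S U).card = (edgesIn E U).card :=
      Finset.card_sdiff_add_card_eq_card (Finset.filter_subset _ _)
    have h2 : (F.card : ℝ) + (edgesBetween (edgesIn E U) S U).card = (edgesIn E U).card := by exact_mod_cast h1
    linarith
  have hFsub : F ⊆ edgesIn E U := Finset.sdiff_subset
  have hdeg : ∀ v, ((nbrR F v).card + (nbrL F v).card) * (U.card : ℝ) ≤ 4 * R * F.card := by
    intro v
    by_cases hv : v ∈ U ∧ v ∉ S
    · have h1 : ¬ 2 * R * ((edgesIn E U).card : ℝ) <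
          ((nbrR (edgesIn E U) v).card + (nbrL (edgesIn E U) v).card) * (U.card : ℝ) :=
        fun h => hv.2 (Finset.mem_filter.2 ⟨hv.1, h⟩)
      have h2 : (nbrR F v).card ≤ (nbrR (edgesIn E U) v).card := Finset.card_le_card fun y hy => by
        rw [mem_nbrR] at hy ⊢; exact hFsub hy
      have h3 : (nbrL F v).card ≤ (nbrL (edgesIn E U) v).card := Finset.card_le_card fun y hy => by
        rw [mem_nbrL] at hy ⊢; exact hFsub hy
      calc ((nbrR F v).card + (nbrL F v).card) * (U.card : ℝ)
          ≤ ((nbrR (edgesIn E U) v).card + (nbrL (edgesIn E U) v).card) * (U.card : ℝ) := by gcongr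
        _ ≤ 2 * R * ((edgesIn E U).card : ℝ) := not_lt.1 h1
        _ ≤ 4 * R * F.card := by nlinarith
    · have hno : ∀ e ∈ F, e.1 ≠ v ∧ e.2 ≠ v := by
        intro e he
        obtain ⟨he1, he2⟩ := Finset.mem_sdiff.1 he
        obtain ⟨-, he3, he4⟩ := Finset.mem_filter.1 he1
        simp only [edgesBetween, Finset.mem_filter] at he2
        constructor <;> (rintro rfl; tauto)
      have h1 : nbrR F v = ∅ := Finset.eq_empty_of_forall_notMem fun y hy =>
        (hno _ (mem_nbrR.1 hy)).1 rfl
      have h2 : nbrL F v = ∅ := Finset.eq_empty_of_forall_notMem fun y hy =>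
        (hno _ (mem_nbrL.1 hy)).2 rfl
      rw [h1, h2]
      simpa using by positivity
  refine ⟨U, F, hFsub.trans (Finset.filter_subset _ _), fun e he => ?_, ?_, ?_, fun v => ?_⟩
  · simpa using (Finset.mem_filter.1 (hFsub he)).2
  · rw [← Finset.card_pos]
    have : (0 : ℝ) < F.card := by linarith
    exact_mod_cast this
  · refine le_trans ?_ hFcard
    rw [he]
    nlinarith
  · have h1 := hdeg v
    rw [add_mul] at h1
    have h2 : (0 : ℝ) ≤ (nbrR F v).card * (U.card : ℝ) := by positivity
    have h3 : (0 : ℝ) ≤ (nbrL F v).card * (U.card : ℝ) := by positivity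
    constructor <;> linarith

/-- The number of homomorphic images of the four-cycle is at least what it is in a random graph of
the same density. -/
lemma card_pow_four_le {W : Finset V} {E : Finset (V × V)} (hEW : E ⊆ W ×ˢ W) :
    (E.card : ℝ) ^ 4 ≤ (W.card : ℝ) ^ 4 *
      ∑ e ∈ E, ((E.filter fun f => (f.1, e.2) ∈ E ∧ (e.1, f.2) ∈ E).card : ℝ) := by
  set r : V → V → ℝ := fun x y => if (x, y) ∈ E then 1 else 0 with hr
  have hsum : ∀ g : V × V → ℝ, ∑ e ∈ E, g e = ∑ x ∈ W, ∑ y ∈ W, r x y * g (x, y) := by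
    intro g
    have h1 : E = (W ×ˢ W).filter (· ∈ E) := by
      ext e
      simp only [Finset.mem_filter]
      exact ⟨fun h => ⟨hEW h, h⟩, fun h => h.2⟩
    conv_lhs => rw [h1]
    rw [Finset.sum_filter, Finset.sum_product]
    simp [hr]
  have hcard : (E.card : ℝ) = ∑ y ∈ W, ∑ x ∈ W, r x y := by
    rw [Finset.card_eq_sum_ones]
    push_cast
    rw [hsum, Finset.sum_comm]
    simp
  have hcount : ∑ e ∈ E, ((E.filter fun f => (f.1, e.2) ∈ E ∧ (e.1, f.2) ∈ E).card : ℝ) =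
      ∑ z ∈ W ×ˢ W, (∑ y ∈ W, r z.1 y * r z.2 y) ^ 2 := by
    have h1 : ∀ e : V × V, ((E.filter fun f => (f.1, e.2) ∈ E ∧ (e.1, f.2) ∈ E).card : ℝ) =
        ∑ x ∈ W, ∑ y ∈ W, r x y * (r x e.2 * r e.1 y) := by
      intro e
      rw [Finset.card_filter]
      push_cast
      rw [hsum]
      refine Finset.sum_congr rfl fun x _ => Finset.sum_congr rfl fun y _ => ?_
      by_cases h1 : (x, e.2) ∈ E <;> by_cases h2 : (e.1, y) ∈ E <;> simp [hr, h1, h2]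
    rw [hsum, Finset.sum_product]
    refine Finset.sum_congr rfl fun u _ => ?_
    rw [Finset.sum_congr rfl fun v (_ : v ∈ W) => congrArg (r u v * ·) (h1 (u, v))]
    simp only [Finset.mul_sum]
    rw [Finset.sum_comm]
    refine Finset.sum_congr rfl fun x _ => ?_
    rw [pow_two, Finset.sum_mul_sum]
    refine Finset.sum_congr rfl fun v _ => Finset.sum_congr rfl fun y _ => ?_
    ring
  rw [hcount]
  set A := ∑ z ∈ W ×ˢ W, ∑ y ∈ W, r z.1 y * r z.2 y with hA
  have h1 : (E.card : ℝ) ^ 2 ≤ W.card * A := by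
    rw [hcard]
    refine sq_sum_le_card_mul_sum_sq.trans (le_of_eq ?_)
    congr 1
    rw [hA, Finset.sum_comm]
    refine Finset.sum_congr rfl fun y _ => ?_
    rw [pow_two, Finset.sum_mul_sum, Finset.sum_product]
  have h2 : A ^ 2 ≤ (W.card : ℝ) ^ 2 *
      ∑ z ∈ W ×ˢ W, (∑ y ∈ W, r z.1 y * r z.2 y) ^ 2 := by
    have := sq_sum_le_card_mul_sum_sq (s := W ×ˢ W) (f := fun z => ∑ y ∈ W, r z.1 y * r z.2 y)
    rw [Finset.card_product] at this
    push_cast at this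
    rwa [← pow_two (W.card : ℝ)] at this
  calc (E.card : ℝ) ^ 4 = ((E.card : ℝ) ^ 2) ^ 2 := by ring
    _ ≤ (W.card * A) ^ 2 := by gcongr
    _ = (W.card : ℝ) ^ 2 * A ^ 2 := by ring
    _ ≤ (W.card : ℝ) ^ 2 * ((W.card : ℝ) ^ 2 *
        ∑ z ∈ W ×ˢ W, (∑ y ∈ W, r z.1 y * r z.2 y) ^ 2) := by gcongr
    _ = _ := by ring

/-- Add to the pattern `R` a left vertex and a right vertex, each adjacent to the whole of the
opposite side. -/
def joinPattern {P Q : Type} (R : P → Q → Prop) (x : Option P) (y : Option Q) : Prop :=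
  ∀ p q, x = some p → y = some q → R p q

/-- The edges `f` that span a four-cycle together with the edge `e`. -/
def linkEdges (F : Finset (V × V)) (e : V × V) : Finset (V × V) :=
  F.filter fun f => ((f.1, e.2) ∈ F ∧ (e.1, f.2) ∈ F) ∧ f.1 ≠ e.1 ∧ f.2 ≠ e.2

lemma containsPattern_join {P Q : Type} {R : P → Q → Prop} (hP : ∀ p, ∃ q, R p q)
    (hQ : ∀ q, ∃ p, R p q) {F : Finset (V × V)} {e : V × V} (he : e ∈ F)
    (h : ContainsPattern R (linkEdges F e)) : ContainsPattern (joinPattern R) F := by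
  obtain ⟨f, g, hf, hg, hfg⟩ := h
  simp only [linkEdges, Finset.mem_filter] at hfg
  refine ⟨fun x => x.elim e.1 f, fun y => y.elim e.2 g, ?_, ?_, ?_⟩
  · rintro (_ | i) (_ | j) hij
    · rfl
    · obtain ⟨q, hq⟩ := hP j
      exact ((hfg j q hq).2.2.1 hij.symm).elim
    · obtain ⟨q, hq⟩ := hP i
      exact ((hfg i q hq).2.2.1 hij).elim
    · exact congrArg some (hf hij)
  · rintro (_ | i) (_ | j) hij
    · rfl
    · obtain ⟨q, hq⟩ := hQ j
      exact ((hfg q j hq).2.2.2 hij.symm).elim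
    · obtain ⟨q, hq⟩ := hQ i
      exact ((hfg q i hq).2.2.2 hij).elim
    · exact congrArg some (hg hij)
  · rintro (_ | i) (_ | j) hij
    · exact he
    · obtain ⟨q, hq⟩ := hQ j
      exact (hfg q j hq).2.1.2
    · obtain ⟨q, hq⟩ := hP i
      exact (hfg i q hq).2.1.1
    · exact (hfg i j (hij i j rfl rfl)).1

lemma card_link_le (F : Finset (V × V)) (e : V × V) :
    (F.filter fun f => (f.1, e.2) ∈ F ∧ (e.1, f.2) ∈ F).card ≤
      (linkEdges F e).card + ((nbrR F e.1).card + (nbrL F e.2).card) := by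
  have hsub : (F.filter fun f => (f.1, e.2) ∈ F ∧ (e.1, f.2) ∈ F) ⊆ linkEdges F e ∪
      ((nbrR F e.1).image (fun y => (e.1, y)) ∪ (nbrL F e.2).image fun x => (x, e.2)) := by
    rintro ⟨x, y⟩ hf
    simp only [linkEdges, Finset.mem_union, Finset.mem_filter, Finset.mem_image, mem_nbrR,
      mem_nbrL, Prod.mk.injEq] at hf ⊢
    by_cases h1 : x = e.1
    · exact Or.inr (Or.inl ⟨y, hf.2.2, h1.symm, rfl⟩)
    by_cases h2 : y = e.2
    · exact Or.inr (Or.inr ⟨x, hf.2.1, rfl, h2.symm⟩)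
    exact Or.inl ⟨hf.1, hf.2, h1, h2⟩
  refine (Finset.card_le_card hsub).trans ((Finset.card_union_le _ _).trans ?_)
  gcongr
  exact (Finset.card_union_le _ _).trans
    (Nat.add_le_add Finset.card_image_le Finset.card_image_le)

theorem Forces.join {P Q : Type} {R : P → Q → Prop} (hP : ∀ p, ∃ q, R p q)
    (hQ : ∀ q, ∃ p, R p q) {p : ℝ} (hp : 1 ≤ p) (hp2 : p < 2) (h : Forces R p) :
    Forces (joinPattern R) ((4 - p) / (3 - p)) := by
  obtain ⟨C', hC', hforce⟩ := h
  have h3p : 0 < 3 - p := by linarith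
  obtain ⟨K, C₀, hK, hC₀, hreg⟩ := exists_almost_regular (p := (4 - p) / (3 - p))
    (by rw [lt_div_iff₀ h3p]; linarith) (by rw [div_le_iff₀ h3p]; linarith)
  set M : ℝ := (C' + 1) * (2 * K) ^ 2 with hM
  have hM0 : 0 < M := by positivity
  refine ⟨C₀ + 2 * (M + 1), by positivity, fun V _ W E hEW hE => ?_⟩
  obtain ⟨U, F, hFE, hFU, hFne, hFcard, hdeg⟩ := hreg V _ (by linarith) W E hEW hE
  by_contra hfree
  have hmN : 0 < U.card := card_pos_of_edges hFU hFne
  have heN : 0 < F.card := Finset.card_pos.2 hFne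
  have hC4 := card_pow_four_le hFU
  obtain ⟨m, hm⟩ : ∃ m : ℝ, m = U.card := ⟨_, rfl⟩
  obtain ⟨e, he⟩ : ∃ e : ℝ, e = F.card := ⟨_, rfl⟩
  have hm0 : 0 < m := by rw [hm]; exact_mod_cast hmN
  have he0 : 0 < e := by rw [he]; exact_mod_cast heN
  rw [← hm, ← he] at hC4 hFcard
  simp only [← hm, ← he] at hdeg
  obtain ⟨q, hq⟩ : ∃ q : ℝ, q = e / m := ⟨_, rfl⟩
  have hq0 : 0 < q := by rw [hq]; positivity
  have heq : e = q * m := by rw [hq]; field_simp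
  have hdegR : ∀ v, ((nbrR F v).card : ℝ) ≤ K * q := fun v => by
    rw [hq, ← mul_div_assoc, le_div_iff₀ hm0]; exact (hdeg v).1
  have hdegL : ∀ v, ((nbrL F v).card : ℝ) ≤ K * q := fun v => by
    rw [hq, ← mul_div_assoc, le_div_iff₀ hm0]; exact (hdeg v).2
  have hKq : 1 ≤ K * q := by
    obtain ⟨f, hf⟩ := hFne
    refine le_trans ?_ (hdegR f.1)
    exact_mod_cast Finset.card_pos.2 ⟨f.2, mem_nbrR.2 hf⟩
  have hlink : ∀ f ∈ F, ((F.filter fun g => (g.1, f.2) ∈ F ∧ (f.1, g.2) ∈ F).card : ℝ) ≤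
      (C' + 1) * (2 * (K * q)) ^ p := by
    intro f hf
    have h1 : ((linkEdges F f).card : ℝ) ≤ C' * ((nbrL F f.2 ∪ nbrR F f.1).card : ℝ) ^ p := by
      by_contra hlt
      refine hfree ((containsPattern_join hP hQ hf (hforce V _ _ ?_ (not_le.1 hlt))).mono hFE)
      intro g hg
      obtain ⟨-, ⟨hg1, hg2⟩, -⟩ := Finset.mem_filter.1 hg
      exact Finset.mem_product.2 ⟨Finset.mem_union_left _ (mem_nbrL.2 hg1),
        Finset.mem_union_right _ (mem_nbrR.2 hg2)⟩
    have h2 : ((nbrL F f.2 ∪ nbrR F f.1).card : ℝ) ≤ 2 * (K * q) := by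
      have : ((nbrL F f.2 ∪ nbrR F f.1).card : ℝ) ≤ (nbrL F f.2).card + (nbrR F f.1).card := by
        exact_mod_cast Finset.card_union_le _ _
      linarith [hdegL f.2, hdegR f.1]
    have h3 : ((nbrL F f.2 ∪ nbrR F f.1).card : ℝ) ^ p ≤ (2 * (K * q)) ^ p :=
      Real.rpow_le_rpow (Nat.cast_nonneg _) h2 (by linarith)
    have h4 : 2 * (K * q) ≤ (2 * (K * q)) ^ p := by
      conv_lhs => rw [← Real.rpow_one (2 * (K * q))]
      exact Real.rpow_le_rpow_of_exponent_le (by linarith) hp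
    have h5 : ((F.filter fun g => (g.1, f.2) ∈ F ∧ (f.1, g.2) ∈ F).card : ℝ) ≤
        (linkEdges F f).card + ((nbrR F f.1).card + (nbrL F f.2).card) := by
      exact_mod_cast card_link_le F f
    have h6 := mul_le_mul_of_nonneg_left h3 hC'.le
    linarith [hdegL f.2, hdegR f.1]
  have hC4' : e ^ 4 ≤ m ^ 4 * (e * ((C' + 1) * (2 * (K * q)) ^ p)) := by
    refine hC4.trans ?_
    gcongr
    refine (Finset.sum_le_card_nsmul _ _ _ hlink).trans (le_of_eq ?_)
    rw [nsmul_eq_mul, he]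
  have h2Kp : (2 * (K * q)) ^ p ≤ (2 * K) ^ 2 * q ^ p := by
    rw [← mul_assoc, Real.mul_rpow (by linarith) hq0.le]
    gcongr
    rw [← Real.rpow_two]
    exact Real.rpow_le_rpow_of_exponent_le (by linarith) hp2.le
  have hq3 : q ^ 3 ≤ m * M * q ^ p := by
    have h1 : e ^ 4 ≤ m ^ 4 * (e * (M * q ^ p)) := by
      refine hC4'.trans ?_
      rw [hM, mul_assoc (C' + 1)]
      gcongr
    rw [heq] at h1
    have h2 : q * m ^ 4 * q ^ 3 ≤ q * m ^ 4 * (m * M * q ^ p) := by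
      calc q * m ^ 4 * q ^ 3 = (q * m) ^ 4 := by ring
        _ ≤ _ := h1
        _ = _ := by ring
    exact le_of_mul_le_mul_left h2 (by positivity)
  have hqp : q ^ (3 - p) ≤ m * M := by
    rw [Real.rpow_sub hq0, div_le_iff₀ (by positivity)]
    exact_mod_cast hq3
  have hlow : (M + 1) * m ^ (1 / (3 - p)) ≤ q := by
    rw [hq, le_div_iff₀ hm0]
    have h1 : m ^ ((4 - p) / (3 - p)) = m ^ (1 / (3 - p)) * m := by
      rw [← Real.rpow_add_one hm0.ne']
      congr 1
      field_simp
      ring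
    rw [h1] at hFcard
    refine le_trans ?_ hFcard
    rw [← mul_assoc]
    gcongr
    linarith
  have hlow' : (M + 1) * m ≤ q ^ (3 - p) := by
    calc (M + 1) * m ≤ (M + 1) ^ (3 - p) * m := by
          gcongr
          conv_lhs => rw [← Real.rpow_one (M + 1)]
          exact Real.rpow_le_rpow_of_exponent_le (by linarith) (by linarith)
      _ = ((M + 1) * m ^ (1 / (3 - p))) ^ (3 - p) := by
          rw [Real.mul_rpow (by positivity) (by positivity), ← Real.rpow_mul hm0.le,
            one_div_mul_cancel h3p.ne', Real.rpow_one]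
      _ ≤ q ^ (3 - p) := by gcongr
  nlinarith

/-- Add to the pattern `R` a set of `k` left vertices and a set of `k` right vertices, each of them
adjacent to the whole of the opposite side. -/
def iterJoinPattern {P Q : Type} (k : ℕ) (R : P → Q → Prop) (x : Fin k ⊕ P) (y : Fin k ⊕ Q) :
    Prop :=
  ∀ p q, x = Sum.inr p → y = Sum.inr q → R p q

/-- Single out the first of the new vertices. -/
def peelFirst {P : Type} (k : ℕ) : Fin (k + 1) ⊕ P → Option (Fin k ⊕ P)
  | Sum.inl i => (finSuccEquiv k i).map Sum.inl
  | Sum.inr p => some (Sum.inr p)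

lemma peelFirst_injective {P : Type} (k : ℕ) : Function.Injective (peelFirst (P := P) k) := by
  rintro (i | p) (j | q) h
  · exact congrArg _ ((finSuccEquiv k).injective (Option.map_injective Sum.inl_injective h))
  · simp [peelFirst] at h
  · simp [peelFirst, eq_comm] at h
  · simpa [peelFirst] using h

lemma peelFirst_eq_inr {P : Type} {k : ℕ} {x : Fin (k + 1) ⊕ P} {p : P}
    (h : peelFirst k x = some (Sum.inr p)) : x = Sum.inr p := by
  rcases x with i | q
  · simp [peelFirst] at h
  · simpa [peelFirst] using h

lemma forces_iterJoin_theta {t : ℕ} (ht : 0 < t) (k : ℕ) :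
    Forces (iterJoinPattern k (thetaPattern t)) (2 - 2 / (2 * k + 3)) := by
  induction k with
  | zero =>
    obtain ⟨C, hC, h⟩ := forces_theta t
    refine ⟨C, hC, fun V _ W E hEW hE => ?_⟩
    have := h V W E hEW (by convert hE using 3; norm_num)
    refine this.comap (Sum.elim Fin.elim0 id) (Sum.elim Fin.elim0 id) ?_ ?_ ?_
    · rintro (i | p) (j | q) h
      all_goals first | exact i.elim0 | exact j.elim0 | simpa using h
    · rintro (i | p) (j | q) h
      all_goals first | exact i.elim0 | exact j.elim0 | simpa using h
    · rintro (i | p) (j | q) h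
      all_goals first | exact i.elim0 | exact j.elim0 | exact h p q rfl rfl
  | succ k ih =>
    have hk : (0 : ℝ) ≤ k := k.cast_nonneg
    have hP : ∀ p, ∃ q, iterJoinPattern k (thetaPattern t) p q := by
      rintro (i | _ | j)
      · exact ⟨Sum.inr none, by simp [iterJoinPattern]⟩
      · exact ⟨Sum.inr (some ⟨0, ht⟩), by simp [iterJoinPattern, thetaPattern]⟩
      · exact ⟨Sum.inr none, by simp [iterJoinPattern, thetaPattern]⟩
    have hQ : ∀ q, ∃ p, iterJoinPattern k (thetaPattern t) p q := by
      rintro (i | _ | j)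
      · exact ⟨Sum.inr none, by simp [iterJoinPattern]⟩
      · exact ⟨Sum.inr (some ⟨0, ht⟩), by simp [iterJoinPattern, thetaPattern]⟩
      · exact ⟨Sum.inr none, by simp [iterJoinPattern, thetaPattern]⟩
    have h1 : (1 : ℝ) ≤ 2 - 2 / (2 * k + 3) := by
      have : 2 / (2 * (k : ℝ) + 3) ≤ 1 := by
        rw [div_le_one (by positivity)]
        linarith
      linarith
    have h2 : 2 - 2 / (2 * (k : ℝ) + 3) < 2 := by
      have : 0 < 2 / (2 * (k : ℝ) + 3) := by positivity
      linarith
    obtain ⟨C, hC, h⟩ := ih.join hP hQ h1 h2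
    have hexp : (4 - (2 - 2 / (2 * (k : ℝ) + 3))) / (3 - (2 - 2 / (2 * (k : ℝ) + 3))) =
        2 - 2 / (2 * ((k + 1 : ℕ) : ℝ) + 3) := by
      have e1 : 4 - (2 - 2 / (2 * (k : ℝ) + 3)) = (4 * k + 8) / (2 * k + 3) := by
        field_simp
        ring
      have e2 : 3 - (2 - 2 / (2 * (k : ℝ) + 3)) = (2 * k + 5) / (2 * k + 3) := by
        field_simp
        ring
      have e3 : 2 * ((k + 1 : ℕ) : ℝ) + 3 = 2 * k + 5 := by
        push_cast
        ring
      rw [e1, e2, e3]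
      field_simp
      ring
    rw [hexp] at h
    refine ⟨C, hC, fun V _ W E hEW hE => ?_⟩
    refine (h V W E hEW hE).comap (peelFirst k) (peelFirst k) (peelFirst_injective k)
      (peelFirst_injective k) fun x y hxy => ?_
    rintro p q hp hq a b rfl rfl
    exact hxy a b (peelFirst_eq_inr hp) (peelFirst_eq_inr hq)

/-- Some bipartition of the vertex set is crossed, in the prescribed direction, by at least a
quarter of the directed edges. -/
lemma exists_cut {n : ℕ} (A : Finset (Fin n × Fin n)) (hA : ∀ e ∈ A, e.1 ≠ e.2) :
    ∃ S : Finset (Fin n), A.card ≤ 4 * (A.filter fun e => e.1 ∈ S ∧ e.2 ∉ S).card := by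
  by_contra! hcon
  have hcount : ∀ e ∈ A,
      4 * (Finset.univ.filter fun S : Finset (Fin n) => e.1 ∈ S ∧ e.2 ∉ S).card = 2 ^ n := by
    intro e he
    have hset : (Finset.univ.filter fun S : Finset (Fin n) => e.1 ∈ S ∧ e.2 ∉ S) =
        Finset.Icc {e.1} {e.2}ᶜ := by
      ext S
      simp [Finset.subset_iff]
    have hsub : ({e.1} : Finset (Fin n)) ⊆ {e.2}ᶜ := by
      simpa using (hA e he).symm
    have hn : 2 ≤ n := by
      have h1 := e.1.isLt
      have h2 := e.2.isLt
      have h3 := Fin.val_ne_of_ne (hA e he)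
      omega
    rw [hset, Finset.card_Icc_finset hsub, Finset.card_compl, Finset.card_singleton,
      Finset.card_singleton, Fintype.card_fin]
    obtain ⟨m, rfl⟩ := Nat.exists_eq_add_of_le hn
    rw [show 2 + m - 1 - 1 = m by omega, pow_add]
    norm_num
  have hdouble : ∑ S : Finset (Fin n), 4 * (A.filter fun e => e.1 ∈ S ∧ e.2 ∉ S).card =
      A.card * 2 ^ n := by
    simp_rw [Finset.card_filter]
    rw [← Finset.mul_sum, Finset.sum_comm, Finset.mul_sum, Finset.card_eq_sum_ones,
      Finset.sum_mul]
    refine Finset.sum_congr rfl fun e he => ?_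
    rw [← Finset.card_filter, hcount e he, one_mul]
  have hlt : ∑ S : Finset (Fin n), 4 * (A.filter fun e => e.1 ∈ S ∧ e.2 ∉ S).card <
      ∑ _S : Finset (Fin n), A.card :=
    Finset.sum_lt_sum_of_nonempty Finset.univ_nonempty fun S _ => hcon S
  rw [hdouble, Finset.sum_const, Finset.card_univ, Fintype.card_finset, Fintype.card_fin,
    smul_eq_mul, mul_comm] at hlt
  exact lt_irrefl _ hlt

/-- The vertex of the left side that plays the role of `a_i`. -/
def leftVertex (k t : ℕ) (i : Fin (k + 1)) : Fin k ⊕ Option (Fin t) :=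
  Fin.lastCases (Sum.inr none) (fun j => Sum.inl j) i

/-- The vertex of the right side that plays the role of `b_i`. -/
def rightVertex (k t : ℕ) (i : Fin (k + 1)) : Fin k ⊕ Option (Fin t) :=
  Fin.cases (Sum.inr none) (fun j => Sum.inl j) i

lemma leftVertex_injective (k t : ℕ) : Function.Injective (leftVertex k t) := by
  intro i j
  induction i using Fin.lastCases <;> induction j using Fin.lastCases <;>
    simp [leftVertex]

lemma rightVertex_injective (k t : ℕ) : Function.Injective (rightVertex k t) := by
  intro i j
  induction i using Fin.cases <;> induction j using Fin.cases <;>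
    simp [rightVertex]

lemma leftVertex_eq_inr {k t : ℕ} {i : Fin (k + 1)} {p : Option (Fin t)}
    (h : leftVertex k t i = Sum.inr p) : i = Fin.last k ∧ p = none := by
  induction i using Fin.lastCases <;> simp_all [leftVertex]

lemma rightVertex_eq_inr {k t : ℕ} {i : Fin (k + 1)} {p : Option (Fin t)}
    (h : rightVertex k t i = Sum.inr p) : i = 0 ∧ p = none := by
  induction i using Fin.cases <;> simp_all [rightVertex]

lemma contains_Hgraph {α : Type*} {k t : ℕ} (hk : 0 < k) {G : SimpleGraph α}
    {S : Finset α} {E : Finset (α × α)} (hE : ∀ e ∈ E, G.Adj e.1 e.2 ∧ e.1 ∈ S ∧ e.2 ∉ S)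
    (h : ContainsPattern (iterJoinPattern k (thetaPattern t)) E) :
    G.Contains (Hgraph (k + 1) t) := by
  obtain ⟨f, g, hf, hg, hfg⟩ := h
  have had : ∀ i (j : Fin t), (f (leftVertex k t i), g (Sum.inr (some j))) ∈ E := by
    intro i j
    refine hfg _ _ fun p q hp hq => ?_
    obtain ⟨-, rfl⟩ := leftVertex_eq_inr hp
    cases hq
    simp [thetaPattern]
  have hcb : ∀ i (j : Fin t), (f (Sum.inr (some j)), g (rightVertex k t i)) ∈ E := by
    intro i j
    refine hfg _ _ fun p q hp hq => ?_
    obtain ⟨-, rfl⟩ := rightVertex_eq_inr hq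
    cases hp
    simp [thetaPattern]
  have hab : ∀ i, (f (leftVertex k t i), g (rightVertex k t i)) ∈ E := by
    intro i
    refine hfg _ _ fun p q hp hq => ?_
    obtain ⟨rfl, -⟩ := leftVertex_eq_inr hp
    obtain ⟨h0, -⟩ := rightVertex_eq_inr hq
    exact absurd (congrArg Fin.val h0) hk.ne'
  have hcd : ∀ j : Fin t, (f (Sum.inr (some j)), g (Sum.inr (some j))) ∈ E := by
    intro j
    refine hfg _ _ fun p q hp hq => ?_
    cases hp
    cases hq
    simp [thetaPattern]
  let φ : (Fin (k + 1) ⊕ Fin t) × Bool → α := fun x => match x with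
    | (Sum.inl i, false) => f (leftVertex k t i)
    | (Sum.inl i, true) => g (rightVertex k t i)
    | (Sum.inr j, false) => g (Sum.inr (some j))
    | (Sum.inr j, true) => f (Sum.inr (some j))
  have hL : ∀ i, f (leftVertex k t i) ∈ S := fun i => (hE _ (hab i)).2.1
  have hR : ∀ i, g (rightVertex k t i) ∉ S := fun i => (hE _ (hab i)).2.2
  have hL' : ∀ j : Fin t, f (Sum.inr (some j)) ∈ S := fun j => (hE _ (hcd j)).2.1
  have hR' : ∀ j : Fin t, g (Sum.inr (some j)) ∉ S := fun j => (hE _ (hcd j)).2.2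
  have hadj : ∀ x y, (x.2 = y.2 ∧ (completeBipartiteGraph (Fin (k + 1)) (Fin t)).Adj x.1 y.1) ∨
      (x.2 ≠ y.2 ∧ x.1 = y.1) → G.Adj (φ x) (φ y) := by
    rintro ⟨i | i, _ | _⟩ ⟨j | j, _ | _⟩ h
    all_goals simp at h
    all_goals try subst h
    · exact (hE _ (hab i)).1
    · exact (hE _ (had i j)).1
    · exact (hE _ (hab i)).1.symm
    · exact (hE _ (hcb i j)).1.symm
    · exact (hE _ (had j i)).1.symm
    · exact (hE _ (hcd i)).1.symm
    · exact (hE _ (hcb j i)).1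
    · exact (hE _ (hcd i)).1
  refine ⟨⟨φ, fun {x y} hxy => ?_⟩, ?_⟩
  · rw [Hgraph, SimpleGraph.fromRel_adj] at hxy
    rcases hxy.2 with h | h
    · exact hadj x y h
    · exact (hadj y x h).symm
  · have hne : ∀ {a b : α}, a ∈ S → b ∉ S → a ≠ b := fun ha hb hab => hb (hab ▸ ha)
    intro x y (h : φ x = φ y)
    rcases x with ⟨i | i, _ | _⟩ <;> rcases y with ⟨j | j, _ | _⟩
    all_goals dsimp only [φ] at h
    · rw [leftVertex_injective _ _ (hf h)]
    · exact absurd h (hne (hL i) (hR j))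
    · exact absurd h (hne (hL i) (hR' j))
    · exact absurd (leftVertex_eq_inr (hf h)).2 (by simp)
    · exact absurd h.symm (hne (hL j) (hR i))
    · rw [rightVertex_injective _ _ (hg h)]
    · exact absurd (rightVertex_eq_inr (hg h)).2 (by simp)
    · exact absurd h.symm (hne (hL' j) (hR i))
    · exact absurd h.symm (hne (hL j) (hR' i))
    · exact absurd (rightVertex_eq_inr (hg h.symm)).2 (by simp)
    · rw [Option.some_injective _ (Sum.inr_injective (hg h))]
    · exact absurd h.symm (hne (hL' j) (hR' i))
    · exact absurd (leftVertex_eq_inr (hf h.symm)).2 (by simp)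
    · exact absurd h (hne (hL' i) (hR j))
    · exact absurd h (hne (hL' i) (hR' j))
    · rw [Option.some_injective _ (Sum.inr_injective (hf h))]

end Patterns

/-- For all $t ≥ s ≥ 2$ there is $C = C(s,t) > 0$ with
$ex(n, H_{s,t}) ≤ C · n^{2 - 2/(2s+1)}$ for all $n$. -/
theorem ex_Hst_upper (s t : ℕ) (hs : 2 ≤ s) (hst : s ≤ t) :
    ∃ C : ℝ, 0 < C ∧ ∀ n : ℕ,
      (exNum n (Hgraph s t) : ℝ) ≤ C * (n : ℝ) ^ ((2 : ℝ) - 2 / (2 * s + 1)) := by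
  classical
  obtain ⟨k, rfl⟩ : ∃ k, s = k + 1 := ⟨s - 1, by omega⟩
  have hk : 0 < k := by omega
  have ht : 0 < t := by omega
  obtain ⟨C, hC, h⟩ := forces_iterJoin_theta ht k
  refine ⟨2 * C, by positivity, fun n => ?_⟩
  rw [show (2 : ℝ) * ((k + 1 : ℕ) : ℝ) + 1 = 2 * k + 3 by push_cast; ring]
  set p : ℝ := 2 - 2 / (2 * k + 3)
  have hnonneg : 0 ≤ 2 * C * (n : ℝ) ^ p := by positivity
  refine le_trans (Nat.cast_le.mpr (csSup_le' ?_)) (Nat.floor_le hnonneg)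
  rintro N ⟨G, hG, rfl⟩
  refine Nat.le_floor ?_
  have hcard : 2 * G.edgeSet.ncard =
      (Finset.univ.filter fun e : Fin n × Fin n => G.Adj e.1 e.2).card := by
    rw [Set.ncard_eq_toFinset_card', ← SimpleGraph.edgeFinset, G.two_mul_card_edgeFinset]
  obtain ⟨S, hS⟩ := exists_cut (Finset.univ.filter fun e : Fin n × Fin n => G.Adj e.1 e.2)
    fun e he => (Finset.mem_filter.mp he).2.ne
  set E := (Finset.univ.filter fun e : Fin n × Fin n => G.Adj e.1 e.2).filter
    fun e => e.1 ∈ S ∧ e.2 ∉ S with hEdef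
  have hE : (E.card : ℝ) ≤ C * (n : ℝ) ^ p := by
    by_contra! hlt
    refine hG (contains_Hgraph hk (S := S) (E := E) (fun e he => ?_)
      (h (Fin n) Finset.univ E (fun e _ => by simp) (by simpa using hlt)))
    simpa [hEdef] using he
  have hle : G.edgeSet.ncard ≤ 2 * E.card := by omega
  calc (G.edgeSet.ncard : ℝ) ≤ 2 * E.card := by exact_mod_cast hle
    _ ≤ 2 * C * (n : ℝ) ^ p := by linarith
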